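/- Let c ∈ ℭ_+(N) and let K be a compact subset of 𝔓_+(N). Then the set {Q ∈ 𝔓_+(N) : F^P(Q) = c for some P ∈ K} is a compact subset of 𝔓_+(N). -/

import Mathlib

open Complex Finset Filter Topology

noncomputable section

/-- Coefficient space for symmetric trigonometric polynomials of degree `n`:
`(p₀, (p₁, …, pₙ))` with `p₀` real and `p₋ₖ = conj pₖ` implicit. Also used for
covariance data `c = (c₀, (c₁, …, cₙ))`. -/
abbrev Coef (n : ℕ) := ℝ × (Fin n → ℂ)

/-- The `2N`-th roots of unity `ζ_j = exp(iπj/N)`. -/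
def zet (N : ℕ) (j : ℤ) : ℂ := Complex.exp (Real.pi * Complex.I * j / N)

/-- The index set `j = -N+1, …, N`. -/
def idxs (N : ℕ) : Finset ℤ := Finset.Icc (-(N : ℤ) + 1) N

/-- Evaluation of `P(z) = Σ_{k=-n}^n p_k z^{-k}` (with `p₋ₖ = conj pₖ`). -/
def evalC {n : ℕ} (p : Coef n) (z : ℂ) : ℂ :=
  (p.1 : ℂ) + ∑ k : Fin n,
    (p.2 k * z⁻¹ ^ ((k : ℕ) + 1) + (starRingEnd ℂ) (p.2 k) * z ^ ((k : ℕ) + 1))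

/-- Real value of the symmetric trigonometric polynomial on the unit circle. -/
def evalR {n : ℕ} (p : Coef n) (z : ℂ) : ℝ := (evalC p z).re

/-- The open cone `𝔓₊(N)`. -/
def Pplus (n N : ℕ) : Set (Coef n) := {p | ∀ j ∈ idxs N, 0 < evalR p (zet N j)}

/-- The closure of `𝔓₊(N)`: `P(ζ_j) ≥ 0` for all `j`. -/
def Pnn (n N : ℕ) : Set (Coef n) := {p | ∀ j ∈ idxs N, 0 ≤ evalR p (zet N j)}

/-- The cone `𝔓₊` of trigonometric polynomials positive on the whole circle. -/
def PplusC (n : ℕ) : Set (Coef n) :=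
  {p | ∀ θ ∈ Set.Icc (-Real.pi) Real.pi, 0 < evalR p (Complex.exp (θ * Complex.I))}

/-- The closure of `𝔓₊`: nonnegative on the whole circle. -/
def PnnC (n : ℕ) : Set (Coef n) :=
  {p | ∀ θ ∈ Set.Icc (-Real.pi) Real.pi, 0 ≤ evalR p (Complex.exp (θ * Complex.I))}

/-- The pairing `⟨C,P⟩ = Σ_{k=-n}^n c_k conj(p_k)` (a real number). -/
def pairCP {n : ℕ} (c p : Coef n) : ℝ :=
  c.1 * p.1 + ∑ k : Fin n, 2 * (c.2 k * (starRingEnd ℂ) (p.2 k)).re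

/-- The open dual cone `ℭ₊(N)`. -/
def Cplus (n N : ℕ) : Set (Coef n) := {c | ∀ p ∈ Pnn n N, p ≠ 0 → 0 < pairCP c p}

/-- The open dual cone `ℭ₊`. -/
def CplusC (n : ℕ) : Set (Coef n) := {c | ∀ p ∈ PnnC n, p ≠ 0 → 0 < pairCP c p}

/-- The discrete moment `(1/(2N)) Σ_j ζ_j^k Φ(ζ_j)`. -/
def dmom (N : ℕ) (Φ : ℤ → ℝ) (k : ℤ) : ℂ :=
  (1 / (2 * (N : ℂ))) * ∑ j ∈ idxs N, zet N j ^ k * (Φ j : ℂ)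

/-- `Φ` (a function of the index `j`) satisfies the moment conditions for `c`. -/
def MomCond {n : ℕ} (N : ℕ) (c : Coef n) (Φ : ℤ → ℝ) : Prop :=
  dmom N Φ 0 = (c.1 : ℂ) ∧ ∀ k : Fin n, dmom N Φ ((k : ℕ) + 1) = c.2 k

/-- The function `j ↦ P(ζ_j)/Q(ζ_j)`. -/
def phiOf {n : ℕ} (N : ℕ) (P Q : Coef n) : ℤ → ℝ :=
  fun j => evalR P (zet N j) / evalR Q (zet N j)

/-- The dual functional `J_P(Q) = ⟨C,Q⟩ − (1/(2N)) Σ_j P(ζ_j) log Q(ζ_j)`. -/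
def JP {n : ℕ} (N : ℕ) (c P Q : Coef n) : ℝ :=
  pairCP c Q - (1 / (2 * (N : ℝ))) * ∑ j ∈ idxs N,
    evalR P (zet N j) * Real.log (evalR Q (zet N j))

/-- The moment map `F^P`, with components `F^P_k(Q) = (1/(2N)) Σ_j ζ_j^k P(ζ_j)/Q(ζ_j)`. -/
def Fmap {n : ℕ} (N : ℕ) (P Q : Coef n) : Coef n :=
  ((dmom N (phiOf N P Q) 0).re, fun k => dmom N (phiOf N P Q) ((k : ℕ) + 1))

theorem star_zet (N : ℕ) (j : ℤ) : (starRingEnd ℂ) (zet N j) = (zet N j)⁻¹ := by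
  simp [zet, ← Complex.exp_conj, ← Complex.exp_neg, neg_div]

theorem evalR_zet {n : ℕ} (N : ℕ) (p : Coef n) (j : ℤ) :
    evalR p (zet N j) =
      p.1 + ∑ k : Fin n, 2 * (zet N j ^ ((k : ℕ) + 1) * (starRingEnd ℂ) (p.2 k)).re := by
  simp only [evalR, evalC, Complex.add_re, Complex.ofReal_re, Complex.re_sum]
  congr 1
  refine Finset.sum_congr rfl fun k _ => ?_
  have h : p.2 k * (zet N j)⁻¹ ^ ((k : ℕ) + 1) =
      (starRingEnd ℂ) (zet N j ^ ((k : ℕ) + 1) * (starRingEnd ℂ) (p.2 k)) := by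
    simp [star_zet, mul_comm]
  rw [h, Complex.conj_re, mul_comm ((starRingEnd ℂ) (p.2 k))]
  ring

theorem continuous_evalR {n : ℕ} (z : ℂ) : Continuous fun p : Coef n => evalR p z := by
  unfold evalR evalC
  have h := Complex.continuous_conj
  fun_prop

theorem evalR_smul {n : ℕ} (t : ℝ) (p : Coef n) (z : ℂ) : evalR (t • p) z = t * evalR p z := by
  have h : evalC (t • p) z = t * evalC p z := by
    simp only [evalC, Prod.smul_fst, Prod.smul_snd, Pi.smul_apply, mul_add, Finset.mul_sum]
    simp [mul_assoc]
  rw [evalR, h, Complex.re_ofReal_mul, evalR]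

theorem continuous_pairCP {n : ℕ} (c : Coef n) : Continuous fun p : Coef n => pairCP c p := by
  unfold pairCP
  have h := Complex.continuous_conj
  fun_prop

theorem pairCP_smul {n : ℕ} (c : Coef n) (t : ℝ) (p : Coef n) :
    pairCP c (t • p) = t * pairCP c p := by
  simp only [pairCP, mul_add, Finset.mul_sum, Prod.smul_fst, Prod.smul_snd, Pi.smul_apply,
    smul_eq_mul]
  congr 1
  · ring
  · refine Finset.sum_congr rfl fun k _ => ?_
    simp
    ring

/-- Pairing a vector of discrete moments of `Φ` with `R` gives the discrete integral of `Φ R`. -/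
theorem pairCP_dmom {n : ℕ} (N : ℕ) (Φ : ℤ → ℝ) (R : Coef n) :
    pairCP ((dmom N Φ 0).re, fun k : Fin n => dmom N Φ ((k : ℕ) + 1)) R =
      1 / (2 * (N : ℝ)) * ∑ j ∈ idxs N, Φ j * evalR R (zet N j) := by
  have hd (k : ℤ) (w : ℂ) : (dmom N Φ k * w).re =
      1 / (2 * (N : ℝ)) * ∑ j ∈ idxs N, Φ j * (zet N j ^ k * w).re := by
    have h : dmom N Φ k * w = ((1 / (2 * (N : ℝ)) : ℝ) : ℂ) *
        ∑ j ∈ idxs N, (Φ j : ℂ) * (zet N j ^ k * w) := by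
      simp only [dmom, mul_assoc, Finset.sum_mul]
      push_cast
      congr 1
      exact Finset.sum_congr rfl fun j _ => by ring
    rw [h, Complex.re_ofReal_mul, Complex.re_sum]
    simp only [Complex.re_ofReal_mul]
  have h0 := hd 0 (R.1 : ℂ)
  simp only [Complex.re_mul_ofReal, zpow_zero, one_mul, Complex.ofReal_re] at h0
  simp only [pairCP, evalR_zet, hd, h0, mul_add, Finset.sum_add_distrib, Finset.mul_sum]
  congr 1
  rw [Finset.sum_comm]
  refine Finset.sum_congr rfl fun j _ => Finset.sum_congr rfl fun k _ => ?_
  norm_cast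
  ring

theorem fst_Fmap {n : ℕ} (N : ℕ) (P Q : Coef n) :
    (Fmap N P Q).1 = 1 / (2 * (N : ℝ)) * ∑ j ∈ idxs N, phiOf N P Q j := by
  have h : dmom N (phiOf N P Q) 0 =
      ((1 / (2 * (N : ℝ)) * ∑ j ∈ idxs N, phiOf N P Q j : ℝ) : ℂ) := by
    simp [dmom]
  rw [Fmap, h, Complex.ofReal_re]

theorem pairCP_Fmap_self {n N : ℕ} (P : Coef n) {Q : Coef n} (hQ : Q ∈ Pplus n N) :
    pairCP (Fmap N P Q) Q = 1 / (2 * (N : ℝ)) * ∑ j ∈ idxs N, evalR P (zet N j) := by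
  rw [Fmap, pairCP_dmom]
  congr 1
  exact Finset.sum_congr rfl fun j hj => div_mul_cancel₀ _ (hQ j hj).ne'

/-- The pairing with an interior point of the dual cone is coercive on the closed cone. -/
theorem exists_mul_norm_le_pairCP {n N : ℕ} {c : Coef n} (hc : c ∈ Cplus n N) :
    ∃ δ > 0, ∀ p ∈ Pnn n N, δ * ‖p‖ ≤ pairCP c p := by
  have hclosed : IsClosed (Pnn n N) := by
    simp only [Pnn, Set.ofPred_forall]
    exact isClosed_iInter fun j => isClosed_iInter fun _ =>
      isClosed_le continuous_const (continuous_evalR _)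
  obtain ⟨δ, hδ, h⟩ := ((isCompact_sphere (0 : Coef n) 1).inter_right hclosed).exists_forall_le'
    (continuous_pairCP c).continuousOn (a := 0) fun p hp =>
      hc p hp.2 (ne_zero_of_mem_unit_sphere ⟨p, hp.1⟩)
  refine ⟨δ, hδ, fun p hp => ?_⟩
  rcases eq_or_ne p 0 with rfl | hp0
  · simp [pairCP]
  have hn : 0 < ‖p‖ := norm_pos_iff.2 hp0
  have hs := h (‖p‖⁻¹ • p) ⟨by simp [norm_smul, hn.ne'], fun j hj => by
    rw [evalR_smul]
    exact mul_nonneg (inv_nonneg.2 hn.le) (hp j hj)⟩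
  rw [pairCP_smul, inv_mul_eq_div, le_div_iff₀ hn] at hs
  exact hs

/-- Each value of `P` is controlled by the corresponding value of `Q` and the zeroth moment. -/
theorem evalR_le_fst_Fmap_mul {n N : ℕ} (hN : 0 < N) {P Q : Coef n} (hP : P ∈ Pplus n N)
    (hQ : Q ∈ Pplus n N) {j : ℤ} (hj : j ∈ idxs N) :
    evalR P (zet N j) ≤ 2 * N * (Fmap N P Q).1 * evalR Q (zet N j) := by
  have hN' : (0 : ℝ) < N := Nat.cast_pos.2 hN
  have h := Finset.single_le_sum (f := phiOf N P Q)
    (fun i hi => (div_pos (hP i hi) (hQ i hi)).le) hj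
  rw [← div_le_iff₀ (hQ j hj), fst_Fmap]
  calc _ ≤ ∑ j ∈ idxs N, phiOf N P Q j := h
    _ = _ := by field_simp

theorem continuousOn_Fmap {n N : ℕ} :
    ContinuousOn (fun x : Coef n × Coef n => Fmap N x.1 x.2) {x | x.2 ∈ Pplus n N} := by
  have hd (k : ℤ) : ContinuousOn (fun x : Coef n × Coef n => dmom N (phiOf N x.1 x.2) k)
      {x | x.2 ∈ Pplus n N} := by
    unfold dmom phiOf
    refine continuousOn_const.mul (continuousOn_finsetSum _ fun j hj => continuousOn_const.mul ?_)
    refine Complex.continuous_ofReal.comp_continuousOn (ContinuousOn.div ?_ ?_ ?_)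
    · exact ((continuous_evalR _).comp continuous_fst).continuousOn
    · exact ((continuous_evalR _).comp continuous_snd).continuousOn
    · exact fun x hx => (hx j hj).ne'
  exact (Complex.continuous_re.comp_continuousOn (hd 0)).prodMk
    (continuousOn_pi.2 fun k => hd _)

/-- **Lemma 11, compactness form.** For `c ∈ ℭ₊(N)` and a compact
`K ⊆ 𝔓₊(N)`, the set of `Q ∈ 𝔓₊(N)` with `F^P(Q) = c` for some `P ∈ K` is compact. -/
theorem Gmap_image_of_compact_compact
    (n N : ℕ) (hn : 1 ≤ n) (hnN : n < N)
    (c : Coef n) (hc : c ∈ Cplus n N)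
    (K : Set (Coef n)) (hK : IsCompact K) (hKP : K ⊆ Pplus n N) :
    IsCompact {Q : Coef n | Q ∈ Pplus n N ∧ ∃ P ∈ K, Fmap N P Q = c} := by
  obtain ⟨δ, hδ, hcoer⟩ := exists_mul_norm_le_pairCP hc
  obtain ⟨M, hM⟩ := hK.bddAbove_image
    (f := fun P => 1 / (2 * (N : ℝ)) * ∑ j ∈ idxs N, evalR P (zet N j))
    (continuous_const.mul (continuous_finsetSum _ fun j _ => continuous_evalR _)).continuousOn
  set B : Set (Coef n × Coef n) := {x | ∀ j ∈ idxs N,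
    evalR x.1 (zet N j) ≤ 2 * N * c.1 * evalR x.2 (zet N j) ∧ 0 ≤ evalR x.2 (zet N j)} with hB
  have hBclosed : IsClosed B := by
    simp only [hB, Set.ofPred_forall]
    have h1 (j : ℤ) := (continuous_evalR (n := n) (zet N j)).comp
      (continuous_fst (X := Coef n) (Y := Coef n))
    have h2 (j : ℤ) := (continuous_evalR (n := n) (zet N j)).comp
      (continuous_snd (X := Coef n) (Y := Coef n))
    exact isClosed_iInter fun j => isClosed_iInter fun _ =>
      (isClosed_le (h1 j) (continuous_const.mul (h2 j))).inter
        (isClosed_le continuous_const (h2 j))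
  set A := (K ×ˢ Metric.closedBall (0 : Coef n) (M / δ)) ∩ B
  have hA : IsCompact A := (hK.prod (isCompact_closedBall _ _)).inter_right hBclosed
  have hApos : A ⊆ {x | x.2 ∈ Pplus n N} := fun x hx j hj => by
    obtain ⟨h1, h2⟩ := hx.2 j hj
    refine h2.lt_of_ne fun h0 => ?_
    rw [← h0, mul_zero] at h1
    exact h1.not_gt (hKP hx.1.1 j hj)
  have hT : IsCompact (A ∩ (fun x => Fmap N x.1 x.2) ⁻¹' {c}) :=
    hA.of_isClosed_subset ((continuousOn_Fmap.mono hApos).preimage_isClosed_of_isClosed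
      hA.isClosed isClosed_singleton) Set.inter_subset_left
  convert hT.image continuous_snd using 1
  ext Q
  constructor
  · rintro ⟨hQ, P, hP, hF⟩
    refine ⟨(P, Q), ⟨⟨⟨hP, ?_⟩, fun j hj => ⟨?_, (hQ j hj).le⟩⟩, hF⟩, rfl⟩
    · rw [mem_closedBall_zero_iff, le_div_iff₀' hδ]
      refine (hcoer Q fun j hj => (hQ j hj).le).trans ?_
      rw [← hF, pairCP_Fmap_self P hQ]
      exact hM ⟨P, hP, rfl⟩
    · rw [← hF]
      exact evalR_le_fst_Fmap_mul (by omega) (hKP hP) hQ hj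
  · rintro ⟨⟨P, Q'⟩, ⟨hA', hF⟩, rfl⟩
    exact ⟨hApos hA', P, hA'.1.1, hF⟩
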